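/- Let Li₂ denote the dilogarithm, defined by Li₂(z) = −∫₀¹ log(1−tz)/t dt, where log is the principal branch of the complex logarithm and the integrand is extended continuously by the value −z at t = 0. Then the imaginary part of Li₂(e^{iπ/3}) equals −2∫₀^{π/6} log(2 sin t) dt; i.e. Im Li₂(e^{iπ/3}) = 2Λ(π/6) = v_tet, the volume of the regular ideal hyperbolic tetrahedron, which appears both as the numerical constant 1.0149416… and in the dilogarithm volume formulas used in the paper. -/

import Mathlib

open Real

/-- The dilogarithm `Li₂(z) = −∫₀¹ log(1−tz)/t dt`, with the principal branch of the
complex logarithm, the integrand extended continuously by the value `−z` at `t = 0`. -/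
noncomputable def Li2 (z : ℂ) : ℂ :=
  -∫ t in (0:ℝ)..1, if t = 0 then -z else Complex.log (1 - (t : ℂ) * z) / (t : ℂ)

/-- The Lobachevsky function `Λ(θ) = −∫₀^θ log(2 sin t) dt`. -/
noncomputable def Lob (θ : ℝ) : ℝ :=
  -∫ t in (0:ℝ)..θ, Real.log (2 * Real.sin t)

/-- Antiderivative of `log ∘ sin`. -/
noncomputable def LS (x : ℝ) : ℝ := ∫ t in (0:ℝ)..x, Real.log (Real.sin t)

lemma LS_int (a b : ℝ) : IntervalIntegrable (fun t => Real.log (Real.sin t)) MeasureTheory.volume a b :=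
  intervalIntegrable_log_sin

lemma LS_continuous : Continuous LS :=
  intervalIntegral.continuous_primitive LS_int 0

lemma LS_hasDerivAt (x : ℝ) (hx : Real.sin x ≠ 0) : HasDerivAt LS (Real.log (Real.sin x)) x := by
  have hc : ContinuousAt (fun t => Real.log (Real.sin t)) x :=
    Real.continuous_sin.continuousAt.log hx
  refine intervalIntegral.integral_hasDerivAt_right (LS_int 0 x) ?_ hc
  refine (Measurable.stronglyMeasurable ?_).stronglyMeasurableAtFilter
  exact Real.measurable_log.comp Real.measurable_sin

lemma LS_two_pi_div_three : LS (2 * π / 3) = -Real.log 2 * π - LS (π / 3) := by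
  have h1 : LS (2 * π / 3) + ∫ t in (2 * π / 3)..π, Real.log (Real.sin t) = -Real.log 2 * π := by
    rw [← integral_log_sin_zero_pi]
    exact intervalIntegral.integral_add_adjacent_intervals (LS_int _ _) (LS_int _ _)
  have h2 : ∫ t in (0:ℝ)..(π / 3), Real.log (Real.sin (π - t))
      = ∫ t in (π - π / 3)..(π - 0), Real.log (Real.sin t) :=
    intervalIntegral.integral_comp_sub_left (fun t => Real.log (Real.sin t)) π
  simp only [Real.sin_pi_sub] at h2
  rw [show π - π / 3 = 2 * π / 3 by ring, sub_zero] at h2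
  rw [← h2] at h1
  unfold LS at *
  linarith

lemma LS_dup : 3 * LS (π / 3) = π / 3 * Real.log 2 + 2 * LS (π / 6) - π * Real.log 2 := by
  have h1 : ∫ t in (0:ℝ)..(π / 6), Real.log (Real.cos t) = -Real.log 2 * π / 2 - LS (π / 3) := by
    have h2 : ∫ t in (0:ℝ)..(π / 6), Real.log (Real.sin (π / 2 - t))
        = ∫ t in (π / 2 - π / 6)..(π / 2 - 0), Real.log (Real.sin t) :=
      intervalIntegral.integral_comp_sub_left (fun t => Real.log (Real.sin t)) (π / 2)
    simp only [Real.sin_pi_div_two_sub] at h2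
    rw [h2, show π / 2 - π / 6 = π / 3 by ring, sub_zero, ← integral_log_sin_zero_pi_div_two,
      ← intervalIntegral.integral_add_adjacent_intervals (LS_int 0 (π / 3)) (LS_int _ _)]
    unfold LS
    ring
  have h3 : LS (π / 3) = 2 * ∫ t in (0:ℝ)..(π / 6), Real.log (Real.sin (2 * t)) := by
    rw [intervalIntegral.mul_integral_comp_mul_left (f := fun t => Real.log (Real.sin t))]
    rw [mul_zero, show 2 * (π / 6) = π / 3 by ring]
    rfl
  have h4 : ∫ t in (0:ℝ)..(π / 6), Real.log (Real.sin (2 * t))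
      = ∫ t in (0:ℝ)..(π / 6), ((Real.log 2 + Real.log (Real.sin t)) + Real.log (Real.cos t)) := by
    refine intervalIntegral.integral_congr_ae (Filter.Eventually.of_forall ?_)
    intro t ht
    rw [Set.uIoc_of_le (by positivity)] at ht
    have hpi := Real.pi_pos
    have hs : 0 < Real.sin t := Real.sin_pos_of_pos_of_lt_pi ht.1 (by linarith [ht.2])
    have hc : 0 < Real.cos t := Real.cos_pos_of_mem_Ioo ⟨by linarith [ht.1], by linarith [ht.2]⟩
    rw [Real.sin_two_mul, Real.log_mul (by positivity) hc.ne', Real.log_mul (by norm_num) hs.ne']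
  have hcos : IntervalIntegrable (fun t => Real.log (Real.cos t)) MeasureTheory.volume 0 (π / 6) :=
    intervalIntegrable_log_cos
  rw [intervalIntegral.integral_add (intervalIntegrable_const.add (LS_int _ _))
    hcos,
    intervalIntegral.integral_add intervalIntegrable_const (LS_int _ _), h1,
    intervalIntegral.integral_const] at h4
  change _ = (π / 6 - 0) • Real.log 2 + LS (π / 6) + _ at h4
  rw [h4, smul_eq_mul] at h3
  linarith

lemma two_sin_integral : ∫ t in (0:ℝ)..(π / 6), Real.log (2 * Real.sin t)
    = π / 6 * Real.log 2 + LS (π / 6) := by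
  have h4 : ∫ t in (0:ℝ)..(π / 6), Real.log (2 * Real.sin t)
      = ∫ t in (0:ℝ)..(π / 6), (Real.log 2 + Real.log (Real.sin t)) := by
    refine intervalIntegral.integral_congr_ae (Filter.Eventually.of_forall ?_)
    intro t ht
    rw [Set.uIoc_of_le (by positivity)] at ht
    have hpi := Real.pi_pos
    have hs : 0 < Real.sin t := Real.sin_pos_of_pos_of_lt_pi ht.1 (by linarith [ht.2])
    rw [Real.log_mul (by norm_num) hs.ne']
  rw [h4, intervalIntegral.integral_add intervalIntegrable_const (LS_int _ _),
    intervalIntegral.integral_const, smul_eq_mul, sub_zero]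
  rfl

/-- The sixth root of unity, in coordinates. -/
noncomputable def zz : ℂ := ⟨1 / 2, √3 / 2⟩

lemma exp_eq_zz : Complex.exp (Complex.I * (Real.pi : ℂ) / 3) = zz := by
  rw [show Complex.I * (Real.pi : ℂ) / 3 = ((π / 3 : ℝ) : ℂ) * Complex.I by push_cast; ring]
  apply Complex.ext
  · rw [Complex.exp_ofReal_mul_I_re, Real.cos_pi_div_three]; rfl
  · rw [Complex.exp_ofReal_mul_I_im, Real.sin_pi_div_three]; rfl

lemma w_re (t : ℝ) : (1 - (t : ℂ) * zz).re = 1 - t / 2 := by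
  simp [zz]; ring

lemma w_im (t : ℝ) : (1 - (t : ℂ) * zz).im = -(t * (√3 / 2)) := by
  simp [zz]

lemma w_slit (t : ℝ) : 1 - (t : ℂ) * zz ∈ Complex.slitPlane := by
  rw [Complex.mem_slitPlane_iff, w_re, w_im]
  by_cases h : t = 0
  · left; simp [h]
  · right; simp [h]

lemma logw_deriv (t : ℝ) :
    HasDerivAt (fun t : ℝ => Complex.log (1 - (t : ℂ) * zz)) (-zz / (1 - (t : ℂ) * zz)) t := by
  have h : HasDerivAt (fun t : ℝ => 1 - (t : ℂ) * zz) (-zz) t := by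
    have := ((Complex.ofRealCLM.hasDerivAt (x := t)).mul_const zz).const_sub 1
    simpa using this
  exact h.clog_real (w_slit t)

/-- The integrand. -/
noncomputable def gg (t : ℝ) : ℂ :=
  if t = 0 then -zz else Complex.log (1 - (t : ℂ) * zz) / (t : ℂ)

lemma gg_cont : Continuous gg := by
  have h : gg = dslope (fun t : ℝ => Complex.log (1 - (t : ℂ) * zz)) 0 := by
    funext t
    by_cases ht : t = 0
    · subst ht
      rw [dslope_same, (logw_deriv 0).deriv]
      simp [gg]
    · rw [dslope_of_ne _ ht, slope_def_module]
      simp [gg, ht, div_eq_inv_mul]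
  rw [continuous_iff_continuousAt]
  intro t
  rw [h]
  by_cases ht : t = 0
  · subst ht
    exact continuousAt_dslope_same.2 (logw_deriv 0).differentiableAt
  · exact (continuousAt_dslope_of_ne ht).2 (logw_deriv t).continuousAt

/-- The angle at the vertex `1` of the triangle `0, 1, t z`. -/
noncomputable def ph (t : ℝ) : ℝ := -(Complex.log (1 - (t : ℂ) * zz)).im

lemma ph_deriv (t : ℝ) : ∃ d, HasDerivAt ph d t :=
  ⟨_, (Complex.imCLM.hasFDerivAt.comp_hasDerivAt t (logw_deriv t)).neg⟩

lemma ph_eq (t : ℝ) : ph t = t * -(gg t).im := by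
  by_cases ht : t = 0
  · simp [ph, ht]
  · have : (t : ℂ) * gg t = Complex.log (1 - (t : ℂ) * zz) := by
      have : (t : ℂ) ≠ 0 := by exact_mod_cast ht
      simp only [gg, ht, if_false]
      field_simp
    rw [ph, ← this]
    simp

lemma sin_ph (t : ℝ) : Real.sin (ph t) = t * (√3 / 2) / ‖1 - (t : ℂ) * zz‖ := by
  rw [ph, Complex.log_im, Real.sin_neg, Complex.sin_arg, w_im]; ring

lemma cos_ph (t : ℝ) : Real.cos (ph t) = (1 - t / 2) / ‖1 - (t : ℂ) * zz‖ := by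
  rw [ph, Complex.log_im, Real.cos_neg,
    Complex.cos_arg (Complex.slitPlane_ne_zero (w_slit t)), w_re]

lemma sin_ph_add (t : ℝ) : Real.sin (ph t + π / 3) = (√3 / 2) / ‖1 - (t : ℂ) * zz‖ := by
  rw [Real.sin_add, sin_ph, cos_ph, Real.cos_pi_div_three, Real.sin_pi_div_three]; ring

lemma ph_one : ph 1 = π / 3 := by
  have : 1 - ((1 : ℝ) : ℂ) * zz = Complex.exp (((-(π / 3) : ℝ) : ℂ) * Complex.I) := by
    apply Complex.ext
    · rw [w_re, Complex.exp_ofReal_mul_I_re, Real.cos_neg, Real.cos_pi_div_three]; norm_num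
    · rw [w_im, Complex.exp_ofReal_mul_I_im, Real.sin_neg, Real.sin_pi_div_three]; norm_num
  have hpi := Real.pi_pos
  rw [ph, this, Complex.log_exp]
  · simp
  · simp; linarith
  · simp; linarith

lemma ph_zero : ph 0 = 0 := by simp [ph]

/-- The antiderivative of `ph t / t`. -/
noncomputable def GG (t : ℝ) : ℝ := ph t * Real.log t - LS (ph t) + LS (ph t + π / 3)

lemma GG_cont : Continuous GG := by
  have him : Continuous fun t => -(gg t).im := (Complex.continuous_im.comp gg_cont).neg
  have hph : Continuous ph := by
    have : ph = fun t => t * -(gg t).im := funext ph_eq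
    rw [this]
    exact continuous_id.mul him
  have h1 : Continuous fun t => ph t * Real.log t := by
    have : (fun t => ph t * Real.log t) = fun t => -(gg t).im * (t * Real.log t) := by
      funext t; rw [ph_eq]; ring
    rw [this]
    exact him.mul Real.continuous_mul_log
  exact (h1.sub (LS_continuous.comp hph)).add
    (LS_continuous.comp (hph.add continuous_const))

lemma GG_deriv (t : ℝ) (ht : 0 < t) : HasDerivAt GG (-(gg t).im) t := by
  obtain ⟨d, hd⟩ := ph_deriv t
  have hn : 0 < ‖1 - (t : ℂ) * zz‖ := norm_pos_iff.2 (Complex.slitPlane_ne_zero (w_slit t))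
  have hs : 0 < Real.sin (ph t) := by rw [sin_ph]; positivity
  have hs2 : 0 < Real.sin (ph t + π / 3) := by rw [sin_ph_add]; positivity
  have hlog : Real.log (Real.sin (ph t)) = Real.log t + Real.log (Real.sin (ph t + π / 3)) := by
    rw [← Real.log_mul ht.ne' hs2.ne', sin_ph, sin_ph_add]; congr 1; ring
  have h := ((hd.mul (Real.hasDerivAt_log ht.ne')).sub
    ((LS_hasDerivAt _ hs.ne').comp t hd)).add
    ((LS_hasDerivAt _ hs2.ne').comp t (hd.add_const (π / 3)))
  refine HasDerivAt.congr_deriv (f := GG) h ?_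
  rw [hlog, ph_eq]
  field_simp
  ring

lemma im_Li2_zz : (Li2 zz).im = LS (2 * π / 3) - 2 * LS (π / 3) := by
  have h0 : Li2 zz = -∫ t in (0:ℝ)..1, gg t := rfl
  have hi := gg_cont.intervalIntegrable (μ := MeasureTheory.volume) 0 1
  have h1 : (∫ t in (0:ℝ)..1, gg t).im = ∫ t in (0:ℝ)..1, (gg t).im :=
    (Complex.imCLM.intervalIntegral_comp_comm hi).symm
  rw [h0, Complex.neg_im, h1, ← intervalIntegral.integral_neg,
    intervalIntegral.integral_eq_sub_of_hasDerivAt_of_le zero_le_one GG_cont.continuousOn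
      (fun t ht => GG_deriv t ht.1)
      ((Complex.continuous_im.comp gg_cont).neg.intervalIntegrable 0 1)]
  simp only [GG, ph_one, ph_zero, Real.log_one, zero_add, zero_mul, mul_zero]
  rw [show π / 3 + π / 3 = 2 * π / 3 by ring]
  have : LS 0 = 0 := by simp [LS]
  rw [this]; ring

/-- `Im Li₂(e^{iπ/3}) = −2∫₀^{π/6} log(2 sin t) dt = 2Λ(π/6) = v_tet`, the volume of the
regular ideal hyperbolic tetrahedron. -/
theorem im_Li2_exp_pi_div_three :
    (Li2 (Complex.exp (Complex.I * (Real.pi : ℂ) / 3))).im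
      = -2 * ∫ t in (0:ℝ)..(Real.pi / 6), Real.log (2 * Real.sin t) ∧
    (Li2 (Complex.exp (Complex.I * (Real.pi : ℂ) / 3))).im = 2 * Lob (Real.pi / 6) := by
  have h : (Li2 (Complex.exp (Complex.I * (Real.pi : ℂ) / 3))).im
      = -2 * ∫ t in (0:ℝ)..(Real.pi / 6), Real.log (2 * Real.sin t) := by
    rw [exp_eq_zz, im_Li2_zz, LS_two_pi_div_three, two_sin_integral]
    linarith [LS_dup]
  refine ⟨h, ?_⟩
  rw [h, Lob]
  ring
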